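/- arXiv:2505.11325 — 2 statements merged into one kernel-verified Lean document; each statement's English description precedes it below -/
import Mathlib

section
/- For every ρ ∈ (−1, 1) and every u ∈ [0, 1], ∫_0^1 H_ρ(u, v) dv = u; that is, averaging the Gaussian copula update function over a uniformly distributed second argument leaves the first argument unchanged. -/
open MeasureTheory ProbabilityTheory

/-- The standard normal cumulative distribution function `Φ`. -/
noncomputable def Phi (t : ℝ) : ℝ := ((gaussianReal 0 1) (Set.Iic t)).toReal

/-- The inverse (quantile function) of the standard normal CDF. -/
noncomputable def PhiInv (u : ℝ) : ℝ := sInf {x : ℝ | u ≤ Phi x}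

/-- The Gaussian copula update function `H_ρ(u,v)`, extended by `H_ρ(0,v) = 0` and
`H_ρ(1,v) = 1`. -/
noncomputable def Hcop (ρ u v : ℝ) : ℝ :=
  if u = 0 then 0
  else if u = 1 then 1
  else Phi ((PhiInv u - ρ * PhiInv v) / Real.sqrt (1 - ρ ^ 2))

lemma Phi_eq_cdf (x : ℝ) : Phi x = cdf (gaussianReal 0 1) x := by
  rw [cdf_eq_real]; rfl

lemma ofReal_Phi (x : ℝ) : ENNReal.ofReal (Phi x) = gaussianReal 0 1 (Set.Iic x) := by
  rw [Phi_eq_cdf, ofReal_cdf]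

lemma monotone_Phi : Monotone Phi := by
  intro x y h
  simpa only [Phi_eq_cdf] using monotone_cdf (gaussianReal 0 1) h

lemma Phi_nonneg (x : ℝ) : 0 ≤ Phi x := ENNReal.toReal_nonneg

lemma Phi_le_one (x : ℝ) : Phi x ≤ 1 := by
  rw [Phi_eq_cdf]; exact cdf_le_one _ x

lemma tendsto_Phi_atBot : Filter.Tendsto Phi Filter.atBot (nhds 0) :=
  (tendsto_cdf_atBot (gaussianReal 0 1)).congr fun x ↦ (Phi_eq_cdf x).symm

lemma tendsto_Phi_atTop : Filter.Tendsto Phi Filter.atTop (nhds 1) :=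
  (tendsto_cdf_atTop (gaussianReal 0 1)).congr fun x ↦ (Phi_eq_cdf x).symm

lemma bddBelow_setOf_le_Phi {u : ℝ} (hu : 0 < u) : BddBelow {x : ℝ | u ≤ Phi x} := by
  obtain ⟨b, hb⟩ := (tendsto_Phi_atBot.eventually (gt_mem_nhds hu)).exists
  refine ⟨b, fun x hx ↦ ?_⟩
  by_contra! h
  exact absurd (hx.trans (monotone_Phi h.le)) (not_le.2 hb)

lemma nonempty_setOf_le_Phi {u : ℝ} (hu : u < 1) : {x : ℝ | u ≤ Phi x}.Nonempty := by
  obtain ⟨b, hb⟩ := (tendsto_Phi_atTop.eventually (lt_mem_nhds hu)).exists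
  exact ⟨b, hb.le⟩

/-- The quantile function and the CDF form a Galois connection on `(0, 1)`. -/
lemma PhiInv_le_iff {u : ℝ} (hu : u ∈ Set.Ioo (0 : ℝ) 1) (x : ℝ) :
    PhiInv u ≤ x ↔ u ≤ Phi x := by
  refine ⟨fun h ↦ ?_, fun h ↦ csInf_le (bddBelow_setOf_le_Phi hu.1) h⟩
  have hright : Filter.Tendsto Phi (nhdsWithin x (Set.Ioi x)) (nhds (Phi x)) := by
    have h' := ((cdf (gaussianReal 0 1)).right_continuous x).mono Set.Ioi_subset_Ici_self
    rw [Phi_eq_cdf]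
    exact Filter.Tendsto.congr (fun y ↦ (Phi_eq_cdf y).symm) h'
  refine ge_of_tendsto hright ?_
  filter_upwards [self_mem_nhdsWithin] with y hy
  obtain ⟨z, hz, hzy⟩ := exists_lt_of_csInf_lt (nonempty_setOf_le_Phi hu.2) (h.trans_lt hy)
  exact le_trans hz (monotone_Phi hzy.le)

lemma Phi_PhiInv {u : ℝ} (hu : u ∈ Set.Ioo (0 : ℝ) 1) : Phi (PhiInv u) = u := by
  refine le_antisymm ?_ ((PhiInv_le_iff hu _).1 le_rfl)
  set q := PhiInv u with hq
  have := nullSingletonClass_gaussianReal (μ := 0) (v := 1) one_ne_zero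
  have h0 : gaussianReal 0 1 {q} = 0 := measure_singleton q
  rw [← measure_cdf (gaussianReal 0 1), StieltjesFunction.measure_singleton,
    ENNReal.ofReal_eq_zero, sub_nonpos, ← Phi_eq_cdf] at h0
  refine h0.trans (le_of_tendsto ((monotone_cdf (gaussianReal 0 1)).tendsto_leftLim q) ?_)
  filter_upwards [self_mem_nhdsWithin] with y hy
  rw [← Phi_eq_cdf]
  by_contra! h
  exact absurd ((PhiInv_le_iff hu y).2 h.le) (not_le.2 hy)

lemma aemeasurable_PhiInv : AEMeasurable PhiInv (volume.restrict (Set.Ioo (0 : ℝ) 1)) := by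
  refine aemeasurable_restrict_of_monotoneOn measurableSet_Ioo fun u hu v hv h ↦ ?_
  rw [PhiInv_le_iff hu, Phi_PhiInv hv]
  exact h

/-- Inverse transform sampling: the quantile function pushes the uniform law on `(0, 1)` to the
standard normal law. -/
lemma map_PhiInv : (volume.restrict (Set.Ioo (0 : ℝ) 1)).map PhiInv = gaussianReal 0 1 := by
  have : IsFiniteMeasure ((volume.restrict (Set.Ioo (0 : ℝ) 1)).map PhiInv) :=
    Measure.isFiniteMeasure_map _ _
  refine Measure.ext_of_Iic _ _ fun x ↦ ?_
  rw [Measure.map_apply_of_aemeasurable aemeasurable_PhiInv measurableSet_Iic, ← ofReal_Phi,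
    Measure.restrict_apply' measurableSet_Ioo]
  have h : PhiInv ⁻¹' Set.Iic x ∩ Set.Ioo 0 1 = Set.Iic (Phi x) ∩ Set.Ioo 0 1 := by
    ext v
    simp only [Set.mem_inter_iff, Set.mem_preimage, Set.mem_Iic]
    exact and_congr_left fun hv ↦ PhiInv_le_iff hv x
  have h' : (Set.Iic (Phi x) ∩ Set.Ioo 0 1 : Set ℝ) =ᵐ[volume]
      (Set.Iic (Phi x) ∩ Set.Ioc 0 1 : Set ℝ) :=
    Filter.EventuallyEq.rfl.inter Ioo_ae_eq_Ioc
  rw [h, measure_congr h', Set.inter_comm, Set.Ioc_inter_Iic, inf_of_le_right (Phi_le_one x),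
    Real.volume_Ioc, sub_zero]

lemma lintegral_gaussianReal_Iic {ρ : ℝ} (hρ : ρ ∈ Set.Ioo (-1 : ℝ) 1) (a : ℝ) :
    ∫⁻ z, gaussianReal 0 1 (Set.Iic ((a - ρ * z) / √(1 - ρ ^ 2))) ∂gaussianReal 0 1 =
      gaussianReal 0 1 (Set.Iic a) := by
  have hpos : 0 < 1 - ρ ^ 2 := by nlinarith [hρ.1, hρ.2]
  have hs : 0 < √(1 - ρ ^ 2) := Real.sqrt_pos.2 hpos
  have hconv : (gaussianReal 0 1).map (ρ * ·) ∗ (gaussianReal 0 1).map (√(1 - ρ ^ 2) * ·) =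
      gaussianReal 0 1 := by
    rw [gaussianReal_map_const_mul, gaussianReal_map_const_mul, gaussianReal_conv_gaussianReal]
    congr 1
    · simp
    · ext
      simp [Real.sq_sqrt hpos.le]
  conv_rhs => rw [← hconv]
  have hS : MeasurableSet ((fun p : ℝ × ℝ ↦ p.1 + p.2) ⁻¹' Set.Iic a) :=
    (measurable_fst.add measurable_snd) measurableSet_Iic
  have : IsProbabilityMeasure ((gaussianReal 0 1).map (√(1 - ρ ^ 2) * ·)) :=
    Measure.isProbabilityMeasure_map (by fun_prop)
  rw [Measure.conv, Measure.map_apply (by fun_prop) measurableSet_Iic, Measure.prod_apply hS,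
    lintegral_map (measurable_measure_prodMk_left hS) (by fun_prop)]
  refine lintegral_congr fun z ↦ ?_
  rw [Measure.map_apply (by fun_prop) (measurable_prodMk_left hS)]
  congr 1
  ext w
  simp only [Set.mem_Iic, Set.mem_preimage]
  rw [le_div_iff₀ hs]
  constructor <;> intro h <;> linarith

lemma integral_Phi_gaussianReal {ρ : ℝ} (hρ : ρ ∈ Set.Ioo (-1 : ℝ) 1) (a : ℝ) :
    ∫ z, Phi ((a - ρ * z) / √(1 - ρ ^ 2)) ∂gaussianReal 0 1 = Phi a := by
  have hmeas : Measurable fun z ↦ Phi ((a - ρ * z) / √(1 - ρ ^ 2)) :=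
    monotone_Phi.measurable.comp (by fun_prop)
  rw [integral_eq_lintegral_of_nonneg_ae (.of_forall fun _ ↦ Phi_nonneg _)
    hmeas.aestronglyMeasurable]
  simp only [ofReal_Phi]
  rw [lintegral_gaussianReal_Iic hρ, Phi]

/-- Averaging the Gaussian copula update function over a uniformly distributed second
argument leaves the first argument unchanged: `∫_0^1 H_ρ(u, v) dv = u`. -/
theorem integral_Hcop_eq (ρ : ℝ) (hρ : ρ ∈ Set.Ioo (-1 : ℝ) 1)
    (u : ℝ) (hu : u ∈ Set.Icc (0 : ℝ) 1) :
    ∫ v in (0 : ℝ)..1, Hcop ρ u v = u := by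
  rcases eq_or_ne u 0 with rfl | h0
  · simp [Hcop]
  rcases eq_or_ne u 1 with rfl | h1
  · simp [Hcop]
  have hu' : u ∈ Set.Ioo (0 : ℝ) 1 := ⟨hu.1.lt_of_ne' h0, hu.2.lt_of_ne h1⟩
  simp only [Hcop, if_neg h0, if_neg h1]
  have hmeas : Measurable fun z ↦ Phi ((PhiInv u - ρ * z) / √(1 - ρ ^ 2)) :=
    monotone_Phi.measurable.comp (by fun_prop)
  have hlaw := integral_Phi_gaussianReal hρ (PhiInv u)
  rw [Phi_PhiInv hu', ← map_PhiInv,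
    integral_map aemeasurable_PhiInv hmeas.aestronglyMeasurable] at hlaw
  rw [intervalIntegral.integral_of_le zero_le_one, integral_Ioc_eq_integral_Ioo]
  exact hlaw
end

section
/- Let (X_M)_{M ≥ N} be a real-valued martingale with respect to a filtration (𝓕_M)_{M ≥ N} on a probability space, such that |X_M − X_{M−1}| ≤ c_M almost surely for every M > N, where the constants c_M ≥ 0 satisfy m := ∑_{M > N} c_M² < ∞. Then for every ε > 0, P(∃ M ≥ N : |X_M − X_N| ≥ ε) ≤ 2·exp(−ε²/(2m)). -/
open MeasureTheory ProbabilityTheory Filter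

/-- On `[-c, c]` the convex function `x ↦ exp (t * x)` lies below its chord. -/
lemma exp_mul_le_cosh_add_sinh_div_mul {c x : ℝ} (t : ℝ) (hx : |x| ≤ c) :
    Real.exp (t * x) ≤ Real.cosh (t * c) + Real.sinh (t * c) / c * x := by
  rcases (abs_nonneg x).trans hx |>.eq_or_lt with hc | hc
  · subst hc
    simp [abs_nonpos_iff.1 hx]
  · obtain ⟨h₁, h₂⟩ := abs_le.1 hx
    have ha : 0 ≤ (c - x) / (2 * c) := div_nonneg (by linarith) (by linarith)
    have hb : 0 ≤ (c + x) / (2 * c) := div_nonneg (by linarith) (by linarith)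
    have h := convexOn_exp.2 (Set.mem_univ (-(t * c))) (Set.mem_univ (t * c)) ha hb
      (by field_simp; ring)
    simp only [smul_eq_mul] at h
    calc Real.exp (t * x)
        = Real.exp ((c - x) / (2 * c) * -(t * c) + (c + x) / (2 * c) * (t * c)) := by
          congr 1
          field_simp
          ring
      _ ≤ (c - x) / (2 * c) * Real.exp (-(t * c)) + (c + x) / (2 * c) * Real.exp (t * c) := h
      _ = Real.cosh (t * c) + Real.sinh (t * c) / c * x := by
          rw [Real.cosh_eq, Real.sinh_eq]
          field_simp
          ring

section

variable {Ω : Type*} {mΩ : MeasurableSpace Ω} {P : Measure Ω} {ℱ : Filtration ℕ mΩ}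
  {X : ℕ → Ω → ℝ} {c : ℕ → ℝ}

lemma ae_abs_sub_zero_le_sum (hinc : ∀ k, ∀ᵐ ω ∂P, |X (k + 1) ω - X k ω| ≤ c k) (k : ℕ) :
    ∀ᵐ ω ∂P, |X k ω - X 0 ω| ≤ ∑ i ∈ Finset.range k, c i := by
  induction k with
  | zero => simp
  | succ k ih =>
    filter_upwards [ih, hinc k] with ω h₁ h₂
    rw [Finset.sum_range_succ]
    have := abs_add_le (X k ω - X 0 ω) (X (k + 1) ω - X k ω)
    rw [sub_add_sub_cancel'] at this
    linarith

namespace MeasureTheory.Martingale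

lemma stronglyMeasurable_exp_mul_sub_zero (hX : Martingale X ℱ P) (t : ℝ) (k : ℕ) :
    StronglyMeasurable[ℱ k] fun ω => Real.exp (t * (X k ω - X 0 ω)) :=
  Real.continuous_exp.comp_stronglyMeasurable
    (((hX.stronglyMeasurable k).sub
      ((hX.stronglyMeasurable 0).mono (ℱ.mono (Nat.zero_le k)))).const_mul t)

/-- A predictable factor times a martingale increment integrates to zero over past events. -/
lemma setIntegral_mul_sub_eq_zero [IsFiniteMeasure P] (hX : Martingale X ℱ P) {k : ℕ}
    {g : Ω → ℝ} (hg : StronglyMeasurable[ℱ k] g)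
    (hint : Integrable (fun ω => g ω * (X (k + 1) ω - X k ω)) P)
    {s : Set Ω} (hs : MeasurableSet[ℱ k] s) :
    ∫ ω in s, g ω * (X (k + 1) ω - X k ω) ∂P = 0 := by
  have hD : Integrable (X (k + 1) - X k) P := (hX.integrable _).sub (hX.integrable _)
  have h₀ : P[X (k + 1) - X k | ℱ k] =ᵐ[P] 0 := by
    filter_upwards [condExp_sub (hX.integrable (k + 1)) (hX.integrable k) (ℱ k),
      hX.2 k (k + 1) k.le_succ, hX.2 k k le_rfl] with ω h₁ h₂ h₃
    simp [h₁, h₂, h₃]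
  have h₁ : P[g * (X (k + 1) - X k) | ℱ k] =ᵐ[P] 0 := by
    refine (condExp_mul_of_stronglyMeasurable_left hg hint hD).trans ?_
    filter_upwards [h₀] with ω h
    exact mul_eq_zero_of_right _ h
  rw [← setIntegral_condExp (ℱ.le k) hint hs]
  exact (integral_congr_ae (ae_restrict_of_ae h₁)).trans (by simp)

variable [IsFiniteMeasure P]

lemma integrable_exp_mul_sub_zero (hX : Martingale X ℱ P)
    (hinc : ∀ k, ∀ᵐ ω ∂P, |X (k + 1) ω - X k ω| ≤ c k) (t : ℝ) (k : ℕ) :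
    Integrable (fun ω => Real.exp (t * (X k ω - X 0 ω))) P := by
  refine Integrable.of_bound
    ((hX.stronglyMeasurable_exp_mul_sub_zero t k).mono (ℱ.le k)).aestronglyMeasurable
    (Real.exp (|t| * ∑ i ∈ Finset.range k, c i)) ?_
  filter_upwards [ae_abs_sub_zero_le_sum hinc k] with ω h
  rw [Real.norm_eq_abs, Real.abs_exp]
  refine Real.exp_le_exp.2 ?_
  calc t * (X k ω - X 0 ω) ≤ |t| * |X k ω - X 0 ω| := by
        rw [← abs_mul]; exact le_abs_self _
    _ ≤ _ := by gcongr

lemma integrable_exp_mul_sub_zero_mul_sub (hX : Martingale X ℱ P)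
    (hinc : ∀ k, ∀ᵐ ω ∂P, |X (k + 1) ω - X k ω| ≤ c k) (t : ℝ) (k : ℕ) :
    Integrable (fun ω => Real.exp (t * (X k ω - X 0 ω)) * (X (k + 1) ω - X k ω)) P :=
  (hX.integrable_exp_mul_sub_zero hinc t k).mul_bdd
    ((hX.integrable (k + 1)).sub (hX.integrable k)).aestronglyMeasurable
    (by simpa [Real.norm_eq_abs] using hinc k)

lemma submartingale_exp_mul_sub_zero (hX : Martingale X ℱ P)
    (hinc : ∀ k, ∀ᵐ ω ∂P, |X (k + 1) ω - X k ω| ≤ c k) (t : ℝ) :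
    Submartingale (fun k ω => Real.exp (t * (X k ω - X 0 ω))) ℱ P := by
  refine submartingale_of_setIntegral_le_succ (hX.stronglyMeasurable_exp_mul_sub_zero t)
    (hX.integrable_exp_mul_sub_zero hinc t) fun k s hs => ?_
  have hE := hX.integrable_exp_mul_sub_zero hinc t k
  have hED := hX.integrable_exp_mul_sub_zero_mul_sub hinc t k
  calc ∫ ω in s, Real.exp (t * (X k ω - X 0 ω)) ∂P
      = ∫ ω in s, Real.exp (t * (X k ω - X 0 ω)) +
          t * (Real.exp (t * (X k ω - X 0 ω)) * (X (k + 1) ω - X k ω)) ∂P := by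
        rw [integral_add hE.integrableOn (hED.const_mul t).integrableOn, integral_const_mul,
          hX.setIntegral_mul_sub_eq_zero (hX.stronglyMeasurable_exp_mul_sub_zero t k) hED hs]
        simp
    _ ≤ ∫ ω in s, Real.exp (t * (X (k + 1) ω - X 0 ω)) ∂P := by
        refine integral_mono (hE.add (hED.const_mul t)).integrableOn
          (hX.integrable_exp_mul_sub_zero hinc t (k + 1)).integrableOn fun ω => ?_
        have h := mul_le_mul_of_nonneg_left (Real.add_one_le_exp (t * (X (k + 1) ω - X k ω)))
          (Real.exp_pos (t * (X k ω - X 0 ω))).le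
        rw [← Real.exp_add, ← mul_add, sub_add_sub_cancel'] at h
        dsimp only
        linarith

end MeasureTheory.Martingale

namespace MeasureTheory.Martingale

variable [IsProbabilityMeasure P]

lemma integral_exp_mul_sub_zero_le (hX : Martingale X ℱ P)
    (hinc : ∀ k, ∀ᵐ ω ∂P, |X (k + 1) ω - X k ω| ≤ c k) (t : ℝ) (k : ℕ) :
    ∫ ω, Real.exp (t * (X k ω - X 0 ω)) ∂P ≤
      Real.exp (t ^ 2 * (∑ i ∈ Finset.range k, c i ^ 2) / 2) := by
  induction k with
  | zero => simp
  | succ k ih =>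
    have hE := hX.integrable_exp_mul_sub_zero hinc t k
    have hED := hX.integrable_exp_mul_sub_zero_mul_sub hinc t k
    have h₀ := hX.setIntegral_mul_sub_eq_zero
      (hX.stronglyMeasurable_exp_mul_sub_zero t k) hED MeasurableSet.univ
    rw [setIntegral_univ] at h₀
    calc ∫ ω, Real.exp (t * (X (k + 1) ω - X 0 ω)) ∂P
        ≤ ∫ ω, Real.cosh (t * c k) * Real.exp (t * (X k ω - X 0 ω)) +
            Real.sinh (t * c k) / c k *
              (Real.exp (t * (X k ω - X 0 ω)) * (X (k + 1) ω - X k ω)) ∂P := by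
          refine integral_mono_ae (hX.integrable_exp_mul_sub_zero hinc t (k + 1))
            ((hE.const_mul _).add (hED.const_mul _)) ?_
          filter_upwards [hinc k] with ω hω
          have h := mul_le_mul_of_nonneg_left (exp_mul_le_cosh_add_sinh_div_mul t hω)
            (Real.exp_pos (t * (X k ω - X 0 ω))).le
          rw [← Real.exp_add, ← mul_add, sub_add_sub_cancel'] at h
          linarith
      _ = Real.cosh (t * c k) * ∫ ω, Real.exp (t * (X k ω - X 0 ω)) ∂P := by
          rw [integral_add (hE.const_mul _) (hED.const_mul _), integral_const_mul,
            integral_const_mul, h₀, mul_zero, add_zero]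
      _ ≤ Real.exp ((t * c k) ^ 2 / 2) *
            Real.exp (t ^ 2 * (∑ i ∈ Finset.range k, c i ^ 2) / 2) := by
          gcongr
          exact Real.cosh_le_exp_half_sq _
      _ = Real.exp (t ^ 2 * (∑ i ∈ Finset.range (k + 1), c i ^ 2) / 2) := by
          rw [← Real.exp_add, Finset.sum_range_succ]
          ring_nf

/-- Chernoff bound for the running maximum of a martingale with bounded increments. -/
lemma measure_exists_le_sub_zero_le_exp (hX : Martingale X ℱ P)
    (hinc : ∀ k, ∀ᵐ ω ∂P, |X (k + 1) ω - X k ω| ≤ c k) {t : ℝ} (ht : 0 ≤ t) (ε : ℝ) (n : ℕ) :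
    P {ω | ∃ k ≤ n, ε ≤ X k ω - X 0 ω} ≤
      ENNReal.ofReal (Real.exp (t ^ 2 * (∑ i ∈ Finset.range n, c i ^ 2) / 2 - t * ε)) := by
  have hmax := maximal_ineq (hX.submartingale_exp_mul_sub_zero hinc t)
    (fun _ _ => (Real.exp_pos _).le) (ε := (Real.exp (t * ε)).toNNReal) n
  rw [Real.coe_toNNReal _ (Real.exp_pos _).le] at hmax
  have hpos : ENNReal.ofReal (Real.exp (t * ε)) ≠ 0 := by simp [Real.exp_pos]
  rw [Real.exp_sub, ENNReal.ofReal_div_of_pos (Real.exp_pos _),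
    ENNReal.le_div_iff_mul_le (Or.inl hpos) (Or.inl ENNReal.ofReal_ne_top), mul_comm]
  refine le_trans ?_ (hmax.trans (ENNReal.ofReal_le_ofReal ?_))
  · refine mul_le_mul_right (measure_mono ?_) _
    rintro ω ⟨k, hk, h⟩
    rw [Set.mem_ofPred_eq, Finset.le_sup'_iff]
    refine ⟨k, Finset.mem_range.2 (Nat.lt_succ_of_le hk), ?_⟩
    gcongr
  · exact (setIntegral_le_integral (hX.integrable_exp_mul_sub_zero hinc t n)
      (Eventually.of_forall fun _ => (Real.exp_pos _).le)).trans
      (hX.integral_exp_mul_sub_zero_le hinc t n)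

/-- One-sided time-uniform Azuma–Hoeffding inequality. -/
lemma measure_exists_le_sub_zero_le (hX : Martingale X ℱ P)
    (hinc : ∀ k, ∀ᵐ ω ∂P, |X (k + 1) ω - X k ω| ≤ c k)
    (hsum : Summable fun k => c k ^ 2) {ε : ℝ} (hε : 0 ≤ ε) :
    P {ω | ∃ k, ε ≤ X k ω - X 0 ω} ≤
      ENNReal.ofReal (Real.exp (-ε ^ 2 / (2 * ∑' k, c k ^ 2))) := by
  have hunion : {ω | ∃ k, ε ≤ X k ω - X 0 ω} = ⋃ n, {ω | ∃ k ≤ n, ε ≤ X k ω - X 0 ω} := by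
    ext ω
    simp only [Set.mem_iUnion, Set.mem_ofPred_eq]
    exact ⟨fun ⟨k, hk⟩ => ⟨k, k, le_rfl, hk⟩, fun ⟨_, k, _, hk⟩ => ⟨k, hk⟩⟩
  have hmono : Monotone fun n => {ω | ∃ k ≤ n, ε ≤ X k ω - X 0 ω} :=
    fun _ _ hab _ ⟨k, hk, h⟩ => ⟨k, hk.trans hab, h⟩
  have hm : 0 ≤ ∑' k, c k ^ 2 := tsum_nonneg fun _ => sq_nonneg _
  rw [hunion, hmono.measure_iUnion]
  refine iSup_le fun n => (hX.measure_exists_le_sub_zero_le_exp hinc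
    (div_nonneg hε hm) ε n).trans (ENNReal.ofReal_le_ofReal (Real.exp_le_exp.2 ?_))
  have hn : ∑ i ∈ Finset.range n, c i ^ 2 ≤ ∑' k, c k ^ 2 :=
    hsum.sum_le_tsum _ fun _ _ => sq_nonneg _
  set m := ∑' k, c k ^ 2
  calc (ε / m) ^ 2 * (∑ i ∈ Finset.range n, c i ^ 2) / 2 - ε / m * ε
      ≤ (ε / m) ^ 2 * m / 2 - ε / m * ε := by gcongr
    _ = -ε ^ 2 / (2 * m) := by
        rcases hm.eq_or_lt with h | h
        · simp [← h]
        · field_simp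
          ring

end MeasureTheory.Martingale

end

/-- Time-uniform (maximal, infinite-horizon) Azuma–Hoeffding inequality: if `(X_k)_{k ≥ 0}`
is a martingale (here `X k` plays the role of `X_{N+k}`, so `X 0 = X_N`) with increments
bounded by constants `c_k` whose squares are summable with sum `m`, then
`P(∃ k, |X_k − X_0| ≥ ε) ≤ 2·exp(−ε²/(2m))`. -/
theorem azuma_hoeffding_time_uniform {Ω : Type*} [mΩ : MeasurableSpace Ω]
    (P : Measure Ω) [IsProbabilityMeasure P] (ℱ : Filtration ℕ mΩ)
    (X : ℕ → Ω → ℝ) (hX : Martingale X ℱ P)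
    (c : ℕ → ℝ) (hc : ∀ k, 0 ≤ c k)
    (hinc : ∀ k, 1 ≤ k → ∀ᵐ ω ∂P, |X k ω - X (k - 1) ω| ≤ c k)
    (hsum : Summable fun k : ℕ => c (k + 1) ^ 2)
    (ε : ℝ) (hε : 0 < ε) :
    P {ω | ∃ k : ℕ, ε ≤ |X k ω - X 0 ω|} ≤
      ENNReal.ofReal (2 * Real.exp (-ε ^ 2 / (2 * ∑' k : ℕ, c (k + 1) ^ 2))) := by
  have hinc' : ∀ k, ∀ᵐ ω ∂P, |X (k + 1) ω - X k ω| ≤ c (k + 1) :=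
    fun k => hinc (k + 1) k.succ_pos
  have hneg : ∀ k, ∀ᵐ ω ∂P, |(-X) (k + 1) ω - (-X) k ω| ≤ c (k + 1) := fun k => by
    filter_upwards [hinc' k] with ω h
    rwa [Pi.neg_apply, Pi.neg_apply, Pi.neg_apply, Pi.neg_apply, neg_sub_neg, abs_sub_comm]
  have hsub : {ω | ∃ k : ℕ, ε ≤ |X k ω - X 0 ω|} ⊆
      {ω | ∃ k, ε ≤ X k ω - X 0 ω} ∪ {ω | ∃ k, ε ≤ (-X) k ω - (-X) 0 ω} := by
    rintro ω ⟨k, hk⟩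
    rcases le_abs.1 hk with h | h
    · exact Or.inl ⟨k, h⟩
    · refine Or.inr ⟨k, ?_⟩
      simp only [Pi.neg_apply]
      linarith
  rw [two_mul (Real.exp _), ENNReal.ofReal_add (Real.exp_pos _).le (Real.exp_pos _).le]
  exact (measure_mono hsub).trans <| (measure_union_le _ _).trans <| add_le_add
    (hX.measure_exists_le_sub_zero_le hinc' hsum hε.le)
    (hX.neg.measure_exists_le_sub_zero_le hneg hsum hε.le)
end
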